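/- Let 0 < α < β < 1. There exists a probability measure μ on I = [0,1], absolutely continuous with respect to Lebesgue measure m, satisfying μ(A) = p₁ μ(T_α^{-1}A) + p₂ μ(T_β^{-1}A) for every Borel set A ⊆ I, whose density g with respect to m has a version that is Lipschitz on every compact subset of (0,1]. -/

import Mathlib

open MeasureTheory Filter Set Topology

noncomputable section

/-- The Liverani–Saussol–Vaienti map `T_a` on `[0,1]`. -/
def lsv (a x : ℝ) : ℝ := if x ≤ 1 / 2 then x * (1 + (2 : ℝ) ^ a * x ^ a) else 2 * x - 1

/-- Random parameter selection: `α` on `[0,p₁)`, `β` on `[p₁,1]`. -/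
def alphaOf (α β p₁ ω : ℝ) : ℝ := if ω < p₁ then α else β

/-- The noise dynamics `φ` on `[0,1]`. -/
def phiMap (p₁ ω : ℝ) : ℝ := if ω < p₁ then ω / p₁ else (ω - p₁) / (1 - p₁)

/-- The skew product `S(x,ω) = (T_{α(ω)} x, φ ω)`. -/
def skewLSV (α β p₁ : ℝ) (p : ℝ × ℝ) : ℝ × ℝ :=
  (lsv (alphaOf α β p₁ p.2) p.1, phiMap p₁ p.2)

/-- The base of inducing, `Δ₀ = (1/2,1] × [0,1]`. -/
def Δ0 : Set (ℝ × ℝ) := Ioc (1 / 2 : ℝ) 1 ×ˢ Icc (0 : ℝ) 1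

/-- A translation-invariant mean on the bounded real sequences. -/
structure IsBanachLimit (Λ : (ℕ → ℝ) → ℝ) : Prop where
  add : ∀ s t : ℕ → ℝ, (∃ B, ∀ n, |s n| ≤ B) → (∃ B, ∀ n, |t n| ≤ B) →
    Λ (fun n => s n + t n) = Λ s + Λ t
  smul : ∀ (c : ℝ) (s : ℕ → ℝ), (∃ B, ∀ n, |s n| ≤ B) → Λ (fun n => c * s n) = c * Λ s
  mono : ∀ s t : ℕ → ℝ, (∃ B, ∀ n, |s n| ≤ B) → (∃ B, ∀ n, |t n| ≤ B) →
    (∀ n, s n ≤ t n) → Λ s ≤ Λ t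
  const : ∀ c : ℝ, Λ (fun _ => c) = c
  shift : ∀ s : ℕ → ℝ, (∃ B, ∀ n, |s n| ≤ B) → Λ (fun n => s (n + 1)) = Λ s

/-- The Cesàro average of the first `n + 1` terms of a sequence. -/
def cesaroAvg (s : ℕ → ℝ) (n : ℕ) : ℝ := (∑ k ∈ Finset.range (n + 1), s k) / (n + 1 : ℝ)

theorem abs_cesaroAvg_le {s : ℕ → ℝ} {B : ℝ} (h : ∀ n, |s n| ≤ B) (n : ℕ) :
    |cesaroAvg s n| ≤ B := by
  have hn : (0 : ℝ) < n + 1 := by positivity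
  rw [cesaroAvg, abs_div, abs_of_pos hn, div_le_iff₀ hn]
  calc |∑ k ∈ Finset.range (n + 1), s k| ≤ ∑ k ∈ Finset.range (n + 1), |s k| :=
        Finset.abs_sum_le_sum_abs _ _
    _ ≤ ∑ k ∈ Finset.range (n + 1), B := Finset.sum_le_sum fun k _ => h k
    _ = B * (n + 1) := by simp [mul_comm]

theorem exists_isBanachLimit : ∃ Λ : (ℕ → ℝ) → ℝ, IsBanachLimit Λ := by
  let U : Ultrafilter ℕ := Ultrafilter.of atTop
  let Λ : (ℕ → ℝ) → ℝ := fun s => limUnder (U : Filter ℕ) (cesaroAvg s)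
  have hlim : ∀ s : ℕ → ℝ, (∃ B, ∀ n, |s n| ≤ B) → Tendsto (cesaroAvg s) U (𝓝 (Λ s)) := by
    rintro s ⟨B, hB⟩
    obtain ⟨l, -, hl⟩ := (isCompact_Icc (a := -B) (b := B)).ultrafilter_le_nhds
      (U.map (cesaroAvg s)) (by
        rw [le_principal_iff, Ultrafilter.coe_map, mem_map]
        exact Eventually.of_forall fun n => abs_le.mp (abs_cesaroAvg_le hB n))
    exact tendsto_nhds_limUnder ⟨l, hl⟩
  refine ⟨Λ, ?_, ?_, ?_, ?_, ?_⟩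
  · intro s t hs ht
    refine Tendsto.limUnder_eq (((hlim s hs).add (hlim t ht)).congr fun n => ?_)
    simp only [cesaroAvg, Finset.sum_add_distrib, add_div]
  · intro c s hs
    refine Tendsto.limUnder_eq (((hlim s hs).const_mul c).congr fun n => ?_)
    simp only [cesaroAvg, ← Finset.mul_sum, mul_div_assoc]
  · intro s t hs ht hst
    refine le_of_tendsto_of_tendsto' (hlim s hs) (hlim t ht) fun n => ?_
    unfold cesaroAvg
    gcongr
    exact hst _
  · intro c
    refine Tendsto.limUnder_eq (tendsto_const_nhds.congr fun n => ?_)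
    have hn : (n : ℝ) + 1 ≠ 0 := by positivity
    simp [cesaroAvg]
    field_simp
  · rintro s ⟨B, hB⟩
    have hU : Tendsto (fun n : ℕ => (s (n + 1) - s 0) / ((n : ℝ) + 1)) U (𝓝 0) := by
      have h1 : Tendsto (fun n : ℕ => (2 * B) * (1 / ((n : ℝ) + 1))) atTop (𝓝 0) := by
        simpa using tendsto_one_div_add_atTop_nhds_zero_nat.const_mul (2 * B)
      refine Tendsto.mono_left (squeeze_zero_norm (fun n => ?_) h1) (Ultrafilter.of_le _)
      have hn : (0 : ℝ) < n + 1 := by positivity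
      rw [Real.norm_eq_abs, abs_div, abs_of_pos hn, mul_one_div]
      gcongr
      exact (abs_sub _ _).trans (by linarith [hB (n + 1), hB 0])
    refine Tendsto.limUnder_eq ?_
    have := (hlim s ⟨B, hB⟩).add hU
    rw [add_zero] at this
    refine this.congr fun n => ?_
    rw [cesaroAvg, cesaroAvg, ← add_div]
    congr 1
    have h1 := Finset.sum_range_succ s (n + 1)
    have h2 := Finset.sum_range_succ' s (n + 1)
    linarith

/-- The left branch of the LSV map. -/
def leftBranch (a y : ℝ) : ℝ := y * (1 + (2 : ℝ) ^ a * y ^ a)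

/-- The derivative of the left branch of the LSV map. -/
def leftDeriv (a y : ℝ) : ℝ := 1 + (a + 1) * ((2 : ℝ) ^ a * y ^ a)

theorem hasDerivAt_leftBranch {a y : ℝ} (hy : 0 < y) :
    HasDerivAt (leftBranch a) (leftDeriv a y) y := by
  have h := (hasDerivAt_id y).mul
    (((Real.hasDerivAt_rpow_const (p := a) (Or.inl hy.ne')).const_mul ((2 : ℝ) ^ a)).const_add 1)
  refine h.congr_deriv ?_
  have : y ^ a = y * y ^ (a - 1) := by
    rw [Real.rpow_sub_one hy.ne']
    field_simp
  simp only [leftDeriv, id, this]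
  ring

theorem leftBranch_strictMonoOn {a : ℝ} (ha : 0 < a) : StrictMonoOn (leftBranch a) (Ici 0) := by
  intro y hy z hz hyz
  have hy0 : 0 ≤ y := hy
  unfold leftBranch
  have : y ^ a ≤ z ^ a := Real.rpow_le_rpow hy hyz.le ha.le
  have h2 : 0 < (2 : ℝ) ^ a := by positivity
  have h3 : 0 ≤ y ^ a := by positivity
  have h4 : (2 : ℝ) ^ a * y ^ a ≤ 2 ^ a * z ^ a := by gcongr
  nlinarith [mul_nonneg h2.le h3]

theorem leftBranch_zero (a : ℝ) : leftBranch a 0 = 0 := by simp [leftBranch]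

theorem two_rpow_mul_half_rpow (a : ℝ) : (2 : ℝ) ^ a * (1 / 2) ^ a = 1 := by
  rw [← Real.mul_rpow (by norm_num) (by norm_num)]
  norm_num

theorem leftBranch_half (a : ℝ) : leftBranch a (1 / 2) = 1 := by
  rw [leftBranch, two_rpow_mul_half_rpow]
  norm_num

theorem leftBranch_surjOn {a : ℝ} (ha : 0 < a) :
    SurjOn (leftBranch a) (Ioc 0 (1 / 2)) (Ioc 0 1) := by
  have hc : ContinuousOn (leftBranch a) (Icc 0 (1 / 2)) := by
    have : Continuous fun y : ℝ => y ^ a := Real.continuous_rpow_const ha.le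
    unfold leftBranch
    fun_prop
  have := intermediate_value_Ioc (by norm_num : (0 : ℝ) ≤ 1 / 2) hc
  rwa [leftBranch_zero, leftBranch_half] at this

/-- The inverse of the left branch of the LSV map. -/
def leftInv (a : ℝ) : ℝ → ℝ := Function.invFunOn (leftBranch a) (Ioc 0 (1 / 2))

theorem leftInv_mem {a x : ℝ} (ha : 0 < a) (hx : x ∈ Ioc (0 : ℝ) 1) :
    leftInv a x ∈ Ioc (0 : ℝ) (1 / 2) :=
  Function.invFunOn_mem (leftBranch_surjOn ha hx)

theorem leftBranch_leftInv {a x : ℝ} (ha : 0 < a) (hx : x ∈ Ioc (0 : ℝ) 1) :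
    leftBranch a (leftInv a x) = x :=
  Function.invFunOn_eq (leftBranch_surjOn ha hx)

theorem leftBranch_mem {a y : ℝ} (ha : 0 < a) (hy : y ∈ Ioc (0 : ℝ) (1 / 2)) :
    leftBranch a y ∈ Ioc (0 : ℝ) 1 := by
  have hm := leftBranch_strictMonoOn ha
  refine ⟨?_, ?_⟩
  · have := hm (mem_Ici.mpr le_rfl) (mem_Ici.mpr hy.1.le) hy.1
    rwa [leftBranch_zero] at this
  · have := hm.monotoneOn (mem_Ici.mpr hy.1.le) (mem_Ici.mpr (by norm_num)) hy.2
    rwa [leftBranch_half] at this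

theorem leftInv_leftBranch {a y : ℝ} (ha : 0 < a) (hy : y ∈ Ioc (0 : ℝ) (1 / 2)) :
    leftInv a (leftBranch a y) = y := by
  have hx := leftBranch_mem ha hy
  exact (leftBranch_strictMonoOn ha).injOn (mem_Ici.mpr (leftInv_mem ha hx).1.le)
    (mem_Ici.mpr hy.1.le) (leftBranch_leftInv ha hx)

theorem leftInv_monotoneOn {a : ℝ} (ha : 0 < a) : MonotoneOn (leftInv a) (Ioc 0 1) := by
  intro x hx y hy hxy
  rw [← (leftBranch_strictMonoOn ha).le_iff_le (mem_Ici.mpr (leftInv_mem ha hx).1.le)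
    (mem_Ici.mpr (leftInv_mem ha hy).1.le), leftBranch_leftInv ha hx, leftBranch_leftInv ha hy]
  exact hxy

theorem leftDeriv_pos {a y : ℝ} (ha : 0 < a) (hy : 0 ≤ y) : 0 < leftDeriv a y := by
  unfold leftDeriv
  positivity

theorem leftDeriv_mono {a y z : ℝ} (ha : 0 < a) (hy : 0 ≤ y) (hyz : y ≤ z) :
    leftDeriv a y ≤ leftDeriv a z := by
  unfold leftDeriv
  gcongr

/-- The transfer operator of the LSV map with parameter `a`. -/
def transfer (a : ℝ) (f : ℝ → ℝ) (x : ℝ) : ℝ :=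
  f (leftInv a x) / leftDeriv a (leftInv a x) + f ((x + 1) / 2) / 2

theorem leftInv_mem_Ioc {a x : ℝ} (ha : 0 < a) (hx : x ∈ Ioc (0 : ℝ) 1) :
    leftInv a x ∈ Ioc (0 : ℝ) 1 :=
  ⟨(leftInv_mem ha hx).1, (leftInv_mem ha hx).2.trans (by norm_num)⟩

theorem rightInv_mem_Ioc {x : ℝ} (hx : x ∈ Ioc (0 : ℝ) 1) : (x + 1) / 2 ∈ Ioc (0 : ℝ) 1 :=
  ⟨by linarith [hx.1], by linarith [hx.2]⟩

/-- The cone of densities preserved by the transfer operators of all LSV maps with parameter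
at most `b`. -/
structure DensityCone (b C : ℝ) (f : ℝ → ℝ) : Prop where
  nonneg : ∀ x ∈ Ioc (0 : ℝ) 1, 0 ≤ f x
  antitone : AntitoneOn f (Ioc 0 1)
  mono : MonotoneOn (fun x => x ^ (b + 1) * f x) (Ioc 0 1)
  bound : ∀ x ∈ Ioc (0 : ℝ) 1, x ^ b * f x ≤ C

theorem antitoneOn_leftTerm {a : ℝ} (ha : 0 < a) {f : ℝ → ℝ}
    (hf0 : ∀ x ∈ Ioc (0 : ℝ) 1, 0 ≤ f x) (hf : AntitoneOn f (Ioc 0 1)) :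
    AntitoneOn (fun x => f (leftInv a x) / leftDeriv a (leftInv a x)) (Ioc 0 1) := by
  intro x hx y hy hxy
  have hm := leftInv_monotoneOn ha hx hy hxy
  have hx' := leftInv_mem_Ioc ha hx
  have hy' := leftInv_mem_Ioc ha hy
  exact div_le_div₀ (hf0 _ hx') (hf hx' hy' hm) (leftDeriv_pos ha hx'.1.le)
    (leftDeriv_mono ha hx'.1.le hm)

theorem antitoneOn_rightTerm {f : ℝ → ℝ} (hf : AntitoneOn f (Ioc 0 1)) :
    AntitoneOn (fun x => f ((x + 1) / 2) / 2) (Ioc 0 1) := by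
  intro x hx y hy hxy
  have := hf (rightInv_mem_Ioc hx) (rightInv_mem_Ioc hy) (by linarith)
  simp only
  linarith

/-- Distortion estimate for the left branch. -/
theorem rpow_div_leftDeriv_mono {a b u v : ℝ} (ha : 0 < a) (hab : a ≤ b) (hu : 0 ≤ u)
    (huv : u ≤ v) :
    (1 + u) ^ (b + 1) / (1 + (a + 1) * u) ≤ (1 + v) ^ (b + 1) / (1 + (a + 1) * v) := by
  have h1u : 0 < 1 + u := by linarith
  have hDu : 0 < 1 + (a + 1) * u := by positivity
  have hDv : 0 < 1 + (a + 1) * v := by nlinarith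
  have hB := one_add_mul_self_le_rpow_one_add (s := (v - u) / (1 + u))
    (by have : 0 ≤ (v - u) / (1 + u) := div_nonneg (by linarith) h1u.le
        linarith) (p := b + 1) (by linarith)
  have hv : 1 + (v - u) / (1 + u) = (1 + v) / (1 + u) := by
    field_simp
    ring
  rw [hv, Real.div_rpow (by linarith) h1u.le, le_div_iff₀ (by positivity)] at hB
  rw [div_le_div_iff₀ hDu hDv]
  have key : (1 + (a + 1) * v) ≤ (1 + (b + 1) * ((v - u) / (1 + u))) * (1 + (a + 1) * u) := by
    have : (1 + (b + 1) * ((v - u) / (1 + u))) * (1 + (a + 1) * u) - (1 + (a + 1) * v)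
        = (v - u) * ((b - a) + (b + 1) * (a + 1) * u - (a + 1) * u) / (1 + u) := by
      field_simp
      ring
    have h2 : 0 ≤ (v - u) * ((b - a) + (b + 1) * (a + 1) * u - (a + 1) * u) / (1 + u) := by
      apply div_nonneg _ h1u.le
      apply mul_nonneg (by linarith)
      have : 0 ≤ b * (a + 1) * u := by
        have : 0 ≤ b := by linarith
        positivity
      nlinarith
    linarith
  calc (1 + u) ^ (b + 1) * (1 + (a + 1) * v)
      ≤ (1 + u) ^ (b + 1) * ((1 + (b + 1) * ((v - u) / (1 + u))) * (1 + (a + 1) * u)) := by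
        gcongr
    _ = ((1 + (b + 1) * ((v - u) / (1 + u))) * (1 + u) ^ (b + 1)) * (1 + (a + 1) * u) := by ring
    _ ≤ _ := by gcongr

theorem monotoneOn_rpow_mul_leftTerm {a b : ℝ} (ha : 0 < a) (hab : a ≤ b) {f : ℝ → ℝ}
    (hf0 : ∀ x ∈ Ioc (0 : ℝ) 1, 0 ≤ f x)
    (hf : MonotoneOn (fun x => x ^ (b + 1) * f x) (Ioc 0 1)) :
    MonotoneOn (fun x => x ^ (b + 1) * (f (leftInv a x) / leftDeriv a (leftInv a x)))
      (Ioc 0 1) := by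
  have key : ∀ x ∈ Ioc (0 : ℝ) 1,
      x ^ (b + 1) * (f (leftInv a x) / leftDeriv a (leftInv a x)) =
        ((leftInv a x) ^ (b + 1) * f (leftInv a x)) *
          ((1 + 2 ^ a * (leftInv a x) ^ a) ^ (b + 1) /
            (1 + (a + 1) * (2 ^ a * (leftInv a x) ^ a))) := by
    intro x hx
    have hy := leftInv_mem ha hx
    have h0 := hy.1
    have h1 : x ^ (b + 1) =
        (leftInv a x) ^ (b + 1) * (1 + 2 ^ a * (leftInv a x) ^ a) ^ (b + 1) := by
      rw [← Real.mul_rpow h0.le (by positivity)]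
      congr 1
      exact (leftBranch_leftInv ha hx).symm
    rw [h1, leftDeriv]
    ring
  intro x hx y hy hxy
  have hm := leftInv_monotoneOn ha hx hy hxy
  have hx' := leftInv_mem_Ioc ha hx
  have hy' := leftInv_mem_Ioc ha hy
  have hx0 := hx'.1
  have hy0 := hy'.1
  simp only
  rw [key x hx, key y hy]
  refine mul_le_mul (hf hx' hy' hm) (rpow_div_leftDeriv_mono ha hab (by positivity) ?_)
    (by positivity) (mul_nonneg (by positivity) (hf0 _ hy'))
  gcongr

theorem monotoneOn_rpow_mul_rightTerm {b : ℝ} (hb : 0 < b) {f : ℝ → ℝ}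
    (hf0 : ∀ x ∈ Ioc (0 : ℝ) 1, 0 ≤ f x)
    (hf : MonotoneOn (fun x => x ^ (b + 1) * f x) (Ioc 0 1)) :
    MonotoneOn (fun x => x ^ (b + 1) * (f ((x + 1) / 2) / 2)) (Ioc 0 1) := by
  have key : ∀ x ∈ Ioc (0 : ℝ) 1, x ^ (b + 1) * (f ((x + 1) / 2) / 2) =
      (((x + 1) / 2) ^ (b + 1) * f ((x + 1) / 2)) * ((2 * x / (x + 1)) ^ (b + 1) / 2) := by
    intro x hx
    have h0 := hx.1
    have h1 : x ^ (b + 1) = ((x + 1) / 2) ^ (b + 1) * (2 * x / (x + 1)) ^ (b + 1) := by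
      rw [← Real.mul_rpow (by positivity) (by positivity)]
      congr 1
      field_simp
    rw [h1]
    ring
  intro x hx y hy hxy
  have hx0 := hx.1
  have hy0 := hy.1
  have hz := rightInv_mem_Ioc hy
  simp only
  rw [key x hx, key y hy]
  refine mul_le_mul (hf (rightInv_mem_Ioc hx) hz (by linarith)) ?_ (by positivity)
    (mul_nonneg (by positivity) (hf0 _ hz))
  have : 2 * x / (x + 1) ≤ 2 * y / (y + 1) := by
    rw [div_le_div_iff₀ (by positivity) (by positivity)]
    nlinarith
  gcongr

theorem rpow_mul_leftTerm_le {a b C : ℝ} (ha : 0 < a) (hab : a ≤ b) (hb : b < 1) (hC : 0 ≤ C)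
    {f : ℝ → ℝ} (hf : ∀ x ∈ Ioc (0 : ℝ) 1, x ^ b * f x ≤ C) {x : ℝ} (hx : x ∈ Ioc (0 : ℝ) 1) :
    x ^ b * (f (leftInv a x) / leftDeriv a (leftInv a x)) ≤ C * (1 - (1 - b) / 3 * x ^ b) := by
  set y := leftInv a x with hy_def
  have hy : y ∈ Ioc (0 : ℝ) (1 / 2) := leftInv_mem ha hx
  have hy0 := hy.1
  have hx0 := hx.1
  have hxy : x = y * (1 + 2 ^ a * y ^ a) := (leftBranch_leftInv ha hx).symm
  set u := (2 : ℝ) ^ a * y ^ a with hu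
  have hu0 : 0 < u := by positivity
  have hu2 : u = (2 * y) ^ a := by rw [hu, Real.mul_rpow (by norm_num) hy0.le]
  have hu1 : u ≤ 1 := by
    rw [hu2]
    exact Real.rpow_le_one (by positivity) (by linarith [hy.2]) ha.le
  have hux : x ^ b ≤ u := by
    calc x ^ b ≤ x ^ a := Real.rpow_le_rpow_of_exponent_ge hx0 hx.2 hab
      _ ≤ (2 * y) ^ a := Real.rpow_le_rpow hx0.le (by nlinarith) ha.le
      _ = u := hu2.symm
  have hB : (1 + u) ^ b ≤ 1 + b * u :=
    rpow_one_add_le_one_add_mul_self (by linarith) (by linarith) hb.le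
  have hD : 0 < 1 + (a + 1) * u := by positivity
  have hfrac : (1 + u) ^ b / (1 + (a + 1) * u) ≤ 1 - (1 - b) / 3 * x ^ b := by
    rw [div_le_iff₀ hD]
    have h1 : (1 - b) / 3 * x ^ b ≤ (1 - b) / 3 * u := by
      gcongr
    have h2 : (1 - b) / 3 * u * (1 + (a + 1) * u) ≤ (1 - b) * u := by
      have : (1 + (a + 1) * u) ≤ 3 := by nlinarith
      have h3 : 0 ≤ (1 - b) / 3 * u := by
        have : 0 ≤ 1 - b := by linarith
        positivity
      nlinarith
    have h4 : (1 - b) / 3 * x ^ b * (1 + (a + 1) * u) ≤ (1 - b) / 3 * u * (1 + (a + 1) * u) := by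
      gcongr
    nlinarith
  have heq : x ^ b * (f y / leftDeriv a y) =
      (y ^ b * f y) * ((1 + u) ^ b / (1 + (a + 1) * u)) := by
    have h1 : x ^ b = y ^ b * (1 + u) ^ b := by
      rw [← Real.mul_rpow hy0.le (by positivity), ← hxy]
    rw [h1, leftDeriv]
    ring
  rw [heq]
  exact mul_le_mul (hf y ⟨hy0, by linarith [hy.2]⟩) hfrac (by positivity) hC

theorem rightTerm_le {b : ℝ} (hb : b < 1) {f : ℝ → ℝ}
    (hf : MonotoneOn (fun x => x ^ (b + 1) * f x) (Ioc 0 1)) (h1 : f 1 ≤ 1) {x : ℝ}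
    (hx : x ∈ Ioc (0 : ℝ) 1) : f ((x + 1) / 2) / 2 ≤ 2 := by
  have hz := rightInv_mem_Ioc hx
  have hm := hf hz (right_mem_Ioc.mpr one_pos) hz.2
  have hm' : ((x + 1) / 2) ^ (b + 1) * f ((x + 1) / 2) ≤ 1 := by
    simp only [Real.one_rpow, one_mul] at hm
    exact hm.trans h1
  have h4 : (1 / 4 : ℝ) ≤ ((x + 1) / 2) ^ (b + 1) := by
    calc (1 / 4 : ℝ) = (1 / 2) ^ (2 : ℝ) := by norm_num
      _ ≤ ((x + 1) / 2) ^ (2 : ℝ) :=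
          Real.rpow_le_rpow (by norm_num) (by linarith [hx.1]) (by norm_num)
      _ ≤ ((x + 1) / 2) ^ (b + 1) :=
          Real.rpow_le_rpow_of_exponent_ge hz.1 hz.2 (by linarith)
  nlinarith

theorem DensityCone.transfer {a b : ℝ} (ha : 0 < a) (hab : a ≤ b) (hb : b < 1) {f : ℝ → ℝ}
    (hf : DensityCone b (6 / (1 - b)) f) (h1 : f 1 ≤ 1) :
    DensityCone b (6 / (1 - b)) (transfer a f) where
  nonneg x hx := by
    have := hf.nonneg _ (leftInv_mem_Ioc ha hx)
    have h2 := hf.nonneg _ (rightInv_mem_Ioc hx)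
    have := leftDeriv_pos ha (leftInv_mem ha hx).1.le
    unfold _root_.transfer
    positivity
  antitone := (antitoneOn_leftTerm ha hf.nonneg hf.antitone).add
    (antitoneOn_rightTerm hf.antitone)
  mono := by
    simpa only [_root_.transfer, mul_add] using
      (monotoneOn_rpow_mul_leftTerm ha hab hf.nonneg hf.mono).add
        (monotoneOn_rpow_mul_rightTerm (ha.trans_le hab) hf.nonneg hf.mono)
  bound x hx := by
    have hb' : 0 < 1 - b := by linarith
    have h2 := rpow_mul_leftTerm_le ha hab hb (by positivity) hf.bound hx
    have h3 := rightTerm_le hb hf.mono h1 hx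
    have h4 : 0 ≤ x ^ b := Real.rpow_nonneg hx.1.le b
    have h5 : 6 / (1 - b) * (1 - (1 - b) / 3 * x ^ b) = 6 / (1 - b) - 2 * x ^ b := by
      field_simp
      ring
    rw [_root_.transfer, mul_add]
    nlinarith

theorem DensityCone.convex_comb {b C p : ℝ} (hp : 0 ≤ p) (hp' : p ≤ 1) {f g : ℝ → ℝ}
    (hf : DensityCone b C f) (hg : DensityCone b C g) :
    DensityCone b C (fun x => p * f x + (1 - p) * g x) where
  nonneg x hx := by
    have := hf.nonneg x hx
    have := hg.nonneg x hx
    have : 0 ≤ 1 - p := by linarith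
    positivity
  antitone x hx y hy hxy := by
    have := hf.antitone hx hy hxy
    have := hg.antitone hx hy hxy
    have : 0 ≤ 1 - p := by linarith
    simp only
    gcongr
  mono x hx y hy hxy := by
    have h1 := hf.mono hx hy hxy
    have h2 := hg.mono hx hy hxy
    have h3 : 0 ≤ 1 - p := by linarith
    simp only at h1 h2 ⊢
    linarith [mul_le_mul_of_nonneg_left h1 hp, mul_le_mul_of_nonneg_left h2 h3]
  bound x hx := by
    have h1 := hf.bound x hx
    have h2 := hg.bound x hx
    have h3 : 0 ≤ 1 - p := by linarith
    linarith [mul_le_mul_of_nonneg_left h1 hp, mul_le_mul_of_nonneg_left h2 h3]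

theorem lsv_of_le {a x : ℝ} (hx : x ≤ 1 / 2) : lsv a x = leftBranch a x := if_pos hx

theorem lsv_of_lt {a x : ℝ} (hx : 1 / 2 < x) : lsv a x = 2 * x - 1 := if_neg hx.not_ge

theorem measurable_lsv (a : ℝ) : Measurable (lsv a) := by
  unfold lsv
  exact Measurable.ite measurableSet_Iic (by fun_prop) (by fun_prop)

theorem lintegral_leftTerm {a : ℝ} (ha : 0 < a) (f : ℝ → ℝ) {A : Set ℝ} (hA : MeasurableSet A) :
    ∫⁻ x in A ∩ Ioc 0 1, ENNReal.ofReal (f (leftInv a x) / leftDeriv a (leftInv a x)) =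
      ∫⁻ x in lsv a ⁻¹' A ∩ Ioc 0 (1 / 2), ENNReal.ofReal (f x) := by
  have himg : leftBranch a '' (lsv a ⁻¹' A ∩ Ioc 0 (1 / 2)) = A ∩ Ioc 0 1 := by
    ext x
    constructor
    · rintro ⟨y, ⟨hyA, hy⟩, rfl⟩
      rw [mem_preimage, lsv_of_le hy.2] at hyA
      exact ⟨hyA, leftBranch_mem ha hy⟩
    · rintro ⟨hxA, hx⟩
      refine ⟨leftInv a x, ⟨?_, leftInv_mem ha hx⟩, leftBranch_leftInv ha hx⟩
      rwa [mem_preimage, lsv_of_le (leftInv_mem ha hx).2, leftBranch_leftInv ha hx]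
  have hS : MeasurableSet (lsv a ⁻¹' A ∩ Ioc 0 (1 / 2)) :=
    (measurable_lsv a hA).inter measurableSet_Ioc
  rw [← himg, lintegral_image_eq_lintegral_abs_deriv_mul hS
    (fun x hx => (hasDerivAt_leftBranch hx.2.1).hasDerivWithinAt)
    ((leftBranch_strictMonoOn ha).injOn.mono fun x hx => mem_Ici.mpr hx.2.1.le)]
  refine setLIntegral_congr_fun hS fun x hx => ?_
  have hD := leftDeriv_pos ha hx.2.1.le
  rw [leftInv_leftBranch ha hx.2, abs_of_pos hD, ← ENNReal.ofReal_mul hD.le,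
    mul_div_cancel₀ _ hD.ne']

theorem lintegral_rightTerm (a : ℝ) (f : ℝ → ℝ) {A : Set ℝ} (hA : MeasurableSet A) :
    ∫⁻ x in A ∩ Ioc 0 1, ENNReal.ofReal (f ((x + 1) / 2) / 2) =
      ∫⁻ x in lsv a ⁻¹' A ∩ Ioc (1 / 2) 1, ENNReal.ofReal (f x) := by
  have himg : (fun y : ℝ => 2 * y - 1) '' (lsv a ⁻¹' A ∩ Ioc (1 / 2) 1) = A ∩ Ioc 0 1 := by
    ext x
    constructor
    · rintro ⟨y, ⟨hyA, hy⟩, rfl⟩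
      rw [mem_preimage, lsv_of_lt hy.1] at hyA
      exact ⟨hyA, by linarith [hy.1], by linarith [hy.2]⟩
    · rintro ⟨hxA, hx⟩
      have hy : 1 / 2 < (x + 1) / 2 := by linarith [hx.1]
      refine ⟨(x + 1) / 2, ⟨?_, hy, by linarith [hx.2]⟩, by simp only; ring⟩
      rw [mem_preimage, lsv_of_lt hy]
      convert hxA using 1
      ring
  have hS : MeasurableSet (lsv a ⁻¹' A ∩ Ioc (1 / 2) 1) :=
    (measurable_lsv a hA).inter measurableSet_Ioc
  have hder : ∀ x : ℝ, HasDerivAt (fun y : ℝ => 2 * y - 1) 2 x := fun x => by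
    simpa using ((hasDerivAt_id x).const_mul 2).sub_const 1
  rw [← himg, lintegral_image_eq_lintegral_abs_deriv_mul hS
    (fun x _ => (hder x).hasDerivWithinAt) (fun x _ y _ hxy => by simpa using hxy)]
  refine setLIntegral_congr_fun hS fun x _ => ?_
  simp only [abs_two]
  rw [← ENNReal.ofReal_mul (by norm_num)]
  congr 1
  ring_nf

theorem aemeasurable_ofReal_of_antitoneOn {f : ℝ → ℝ} (hf : AntitoneOn f (Ioc 0 1)) (A : Set ℝ) :
    AEMeasurable (fun x => ENNReal.ofReal (f x)) (volume.restrict (A ∩ Ioc 0 1)) :=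
  ((aemeasurable_restrict_of_antitoneOn measurableSet_Ioc hf).mono_measure
    (Measure.restrict_mono inter_subset_right le_rfl)).ennreal_ofReal

theorem lintegral_ofReal_add_of_antitoneOn {f g : ℝ → ℝ} (hf : AntitoneOn f (Ioc 0 1))
    (hf0 : ∀ x ∈ Ioc (0 : ℝ) 1, 0 ≤ f x) (hg0 : ∀ x ∈ Ioc (0 : ℝ) 1, 0 ≤ g x) {A : Set ℝ}
    (hA : MeasurableSet A) :
    ∫⁻ x in A ∩ Ioc 0 1, ENNReal.ofReal (f x + g x) =
      (∫⁻ x in A ∩ Ioc 0 1, ENNReal.ofReal (f x)) + ∫⁻ x in A ∩ Ioc 0 1, ENNReal.ofReal (g x) := by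
  rw [← lintegral_add_left' (aemeasurable_ofReal_of_antitoneOn hf A)]
  exact setLIntegral_congr_fun (hA.inter measurableSet_Ioc) fun x hx =>
    ENNReal.ofReal_add (hf0 x hx.2) (hg0 x hx.2)

/-- Duality between the transfer operator and the LSV map. -/
theorem lintegral_transfer {a : ℝ} (ha : 0 < a) {f : ℝ → ℝ}
    (hf0 : ∀ x ∈ Ioc (0 : ℝ) 1, 0 ≤ f x) (hf : AntitoneOn f (Ioc 0 1)) {A : Set ℝ}
    (hA : MeasurableSet A) :
    ∫⁻ x in A ∩ Ioc 0 1, ENNReal.ofReal (transfer a f x) =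
      ∫⁻ x in lsv a ⁻¹' A ∩ Ioc 0 1, ENNReal.ofReal (f x) := by
  unfold transfer
  rw [lintegral_ofReal_add_of_antitoneOn (antitoneOn_leftTerm ha hf0 hf)
    (fun x hx => div_nonneg (hf0 _ (leftInv_mem_Ioc ha hx))
      (leftDeriv_pos ha (leftInv_mem ha hx).1.le).le)
    (fun x hx => div_nonneg (hf0 _ (rightInv_mem_Ioc hx)) zero_le_two) hA,
    lintegral_leftTerm ha f hA, lintegral_rightTerm a f hA,
    ← Ioc_union_Ioc_eq_Ioc (by norm_num : (0 : ℝ) ≤ 1 / 2) (by norm_num : (1 / 2 : ℝ) ≤ 1),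
    inter_union_distrib_left, lintegral_union ((measurable_lsv a hA).inter measurableSet_Ioc)]
  exact (Ioc_disjoint_Ioc_of_le le_rfl).mono inter_subset_right inter_subset_right

/-- The averaged transfer operator of the random map. -/
def randomTransfer (α β p : ℝ) (f : ℝ → ℝ) (x : ℝ) : ℝ :=
  p * transfer α f x + (1 - p) * transfer β f x

theorem DensityCone.randomTransfer {α β p : ℝ} (hα : 0 < α) (hαβ : α < β) (hβ : β < 1)
    (hp : 0 < p) (hp' : p < 1) {f : ℝ → ℝ} (hf : DensityCone β (6 / (1 - β)) f) (h1 : f 1 ≤ 1) :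
    DensityCone β (6 / (1 - β)) (randomTransfer α β p f) :=
  (hf.transfer hα hαβ.le hβ h1).convex_comb hp.le hp'.le
    (hf.transfer (hα.trans hαβ) le_rfl hβ h1)

theorem transfer_nonneg {a : ℝ} (ha : 0 < a) {f : ℝ → ℝ} (hf : ∀ x ∈ Ioc (0 : ℝ) 1, 0 ≤ f x)
    {x : ℝ} (hx : x ∈ Ioc (0 : ℝ) 1) : 0 ≤ transfer a f x :=
  add_nonneg (div_nonneg (hf _ (leftInv_mem_Ioc ha hx))
    (leftDeriv_pos ha (leftInv_mem ha hx).1.le).le)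
    (div_nonneg (hf _ (rightInv_mem_Ioc hx)) zero_le_two)

theorem transfer_antitoneOn {a : ℝ} (ha : 0 < a) {f : ℝ → ℝ}
    (hf0 : ∀ x ∈ Ioc (0 : ℝ) 1, 0 ≤ f x) (hf : AntitoneOn f (Ioc 0 1)) :
    AntitoneOn (transfer a f) (Ioc 0 1) :=
  (antitoneOn_leftTerm ha hf0 hf).add (antitoneOn_rightTerm hf)

theorem lintegral_randomTransfer {α β p : ℝ} (hα : 0 < α) (hβ : 0 < β) (hp : 0 ≤ p)
    (hp' : p ≤ 1) {f : ℝ → ℝ} (hf0 : ∀ x ∈ Ioc (0 : ℝ) 1, 0 ≤ f x)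
    (hf : AntitoneOn f (Ioc 0 1)) {A : Set ℝ} (hA : MeasurableSet A) :
    ∫⁻ x in A ∩ Ioc 0 1, ENNReal.ofReal (randomTransfer α β p f x) =
      ENNReal.ofReal p * (∫⁻ x in lsv α ⁻¹' A ∩ Ioc 0 1, ENNReal.ofReal (f x)) +
        ENNReal.ofReal (1 - p) * ∫⁻ x in lsv β ⁻¹' A ∩ Ioc 0 1, ENNReal.ofReal (f x) := by
  have hq : 0 ≤ 1 - p := by linarith
  unfold randomTransfer
  rw [lintegral_ofReal_add_of_antitoneOn
    (fun x hx y hy hxy => mul_le_mul_of_nonneg_left (transfer_antitoneOn hα hf0 hf hx hy hxy) hp)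
    (fun x hx => mul_nonneg hp (transfer_nonneg hα hf0 hx))
    (fun x hx => mul_nonneg hq (transfer_nonneg hβ hf0 hx)) hA]
  simp only [ENNReal.ofReal_mul hp, ENNReal.ofReal_mul hq]
  rw [lintegral_const_mul' _ _ ENNReal.ofReal_ne_top,
    lintegral_const_mul' _ _ ENNReal.ofReal_ne_top,
    lintegral_transfer hα hf0 hf hA, lintegral_transfer hβ hf0 hf hA]

theorem apply_one_le_one {f : ℝ → ℝ} (hf : AntitoneOn f (Ioc 0 1))
    (hmass : ∫⁻ x in Ioc 0 1, ENNReal.ofReal (f x) = 1) : f 1 ≤ 1 := by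
  have h : ∫⁻ _ in Ioc (0 : ℝ) 1, ENNReal.ofReal (f 1) ≤ 1 := by
    rw [← hmass]
    exact setLIntegral_mono' measurableSet_Ioc fun x hx =>
      ENNReal.ofReal_le_ofReal (hf hx (right_mem_Ioc.mpr one_pos) hx.2)
  rw [setLIntegral_const, Real.volume_Ioc] at h
  simpa using h

theorem densityCone_one {b : ℝ} (hb0 : 0 < b) (hb : b < 1) :
    DensityCone b (6 / (1 - b)) (fun _ => 1) where
  nonneg _ _ := zero_le_one
  antitone := antitoneOn_const
  mono x hx y _ hxy := by
    simp only [mul_one]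
    exact Real.rpow_le_rpow hx.1.le hxy (by linarith)
  bound x hx := by
    have h1 : x ^ b ≤ 1 := Real.rpow_le_one hx.1.le hx.2 hb0.le
    have h2 : 1 ≤ 6 / (1 - b) := by
      rw [le_div_iff₀ (by linarith)]
      linarith
    linarith

theorem iterate_randomTransfer {α β p : ℝ} (hα : 0 < α) (hαβ : α < β) (hβ : β < 1)
    (hp : 0 < p) (hp' : p < 1) (n : ℕ) :
    DensityCone β (6 / (1 - β)) ((randomTransfer α β p)^[n] fun _ => 1) ∧
      ∫⁻ x in Ioc 0 1, ENNReal.ofReal ((randomTransfer α β p)^[n] (fun _ => 1) x) = 1 := by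
  induction n with
  | zero => exact ⟨densityCone_one (hα.trans hαβ) hβ, by simp⟩
  | succ n ih =>
    rw [Function.iterate_succ_apply']
    refine ⟨ih.1.randomTransfer hα hαβ hβ hp hp' (apply_one_le_one ih.1.antitone ih.2), ?_⟩
    have h := lintegral_randomTransfer hα (hα.trans hαβ) hp.le hp'.le ih.1.nonneg ih.1.antitone
      MeasurableSet.univ
    simp only [preimage_univ, univ_inter, ih.2, mul_one] at h
    rw [h, ← ENNReal.ofReal_add hp.le (by linarith)]
    simp

theorem lintegral_rpow_neg {b C δ : ℝ} (hb : b < 1) (hC : 0 ≤ C) (hδ : 0 ≤ δ) :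
    ∫⁻ x in Ioc 0 δ, ENNReal.ofReal (C * x ^ (-b)) =
      ENNReal.ofReal (C * (δ ^ (1 - b) / (1 - b))) := by
  have hi : IntervalIntegrable (fun x : ℝ => C * x ^ (-b)) volume 0 δ :=
    (intervalIntegral.intervalIntegrable_rpow' (by linarith)).const_mul C
  rw [← ofReal_integral_eq_lintegral_ofReal
    ((intervalIntegrable_iff_integrableOn_Ioc_of_le hδ).mp hi)
    ((ae_restrict_iff' measurableSet_Ioc).mpr (Eventually.of_forall fun x hx =>
      mul_nonneg hC (Real.rpow_nonneg hx.1.le _))),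
    ← intervalIntegral.integral_of_le hδ, intervalIntegral.integral_const_mul,
    integral_rpow (Or.inl (by linarith)), neg_add_eq_sub,
    Real.zero_rpow (by linarith), sub_zero]

theorem DensityCone.le_rpow {b C : ℝ} {f : ℝ → ℝ} (hf : DensityCone b C f) {x : ℝ}
    (hx : x ∈ Ioc (0 : ℝ) 1) : f x ≤ C * x ^ (-b) := by
  rw [Real.rpow_neg hx.1.le, ← div_eq_mul_inv, le_div_iff₀ (Real.rpow_pos_of_pos hx.1 b), mul_comm]
  exact hf.bound x hx

theorem DensityCone.lintegral_le {b C δ : ℝ} (hb : b < 1) (hC : 0 ≤ C) (hδ : 0 ≤ δ)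
    (hδ1 : δ ≤ 1) {f : ℝ → ℝ} (hf : DensityCone b C f) :
    ∫⁻ x in Ioc 0 δ, ENNReal.ofReal (f x) ≤ ENNReal.ofReal (C * (δ ^ (1 - b) / (1 - b))) := by
  rw [← lintegral_rpow_neg hb hC hδ]
  exact setLIntegral_mono' measurableSet_Ioc fun x hx =>
    ENNReal.ofReal_le_ofReal (hf.le_rpow ⟨hx.1, hx.2.trans hδ1⟩)

/-- Normalised densities in the cone are uniformly bounded below at some point. -/
theorem exists_half_le_apply {b C : ℝ} (hb : b < 1) (hC : 0 < C) :
    ∃ δ ∈ Ioc (0 : ℝ) 1, ∀ f : ℝ → ℝ, DensityCone b C f →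
      ∫⁻ x in Ioc 0 1, ENNReal.ofReal (f x) = 1 → 1 / 2 ≤ f δ := by
  have hb' : 0 < 1 - b := by linarith
  have hlim : Tendsto (fun δ : ℝ => C * (δ ^ (1 - b) / (1 - b))) (𝓝[>] 0) (𝓝 0) := by
    have h1 : Tendsto (fun δ : ℝ => δ ^ (1 - b)) (𝓝[>] 0) (𝓝 0) := by
      have := (Real.continuousAt_rpow_const 0 (1 - b) (Or.inr hb'.le)).tendsto
      rw [Real.zero_rpow hb'.ne'] at this
      exact this.mono_left nhdsWithin_le_nhds
    simpa using (h1.div_const (1 - b)).const_mul C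
  obtain ⟨δ, hδ, hδ0⟩ := ((hlim.eventually (gt_mem_nhds (by norm_num : (0 : ℝ) < 1 / 2))).and
    (Ioo_mem_nhdsGT one_pos)).exists
  refine ⟨δ, ⟨hδ0.1, hδ0.2.le⟩, fun f hf hmass => ?_⟩
  by_contra! hlt
  have hL := hf.lintegral_le hb hC.le hδ0.1.le hδ0.2.le
  have hR : ∫⁻ x in Ioc δ 1, ENNReal.ofReal (f x) ≤ ENNReal.ofReal (1 / 2) := by
    calc ∫⁻ x in Ioc δ 1, ENNReal.ofReal (f x)
        ≤ ∫⁻ _ in Ioc δ 1, ENNReal.ofReal (1 / 2) :=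
          setLIntegral_mono' measurableSet_Ioc fun x hx => ENNReal.ofReal_le_ofReal
            ((hf.antitone ⟨hδ0.1, hδ0.2.le⟩ ⟨hδ0.1.trans hx.1, hx.2⟩ hx.1.le).trans hlt.le)
      _ = ENNReal.ofReal (1 / 2) * ENNReal.ofReal (1 - δ) := by
          rw [setLIntegral_const, Real.volume_Ioc]
      _ ≤ ENNReal.ofReal (1 / 2) * 1 := by
          gcongr
          exact ENNReal.ofReal_le_one.mpr (by linarith [hδ0.1])
      _ = _ := mul_one _
  have hlt1 : ∫⁻ x in Ioc 0 1, ENNReal.ofReal (f x) < 1 := by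
    rw [← Ioc_union_Ioc_eq_Ioc hδ0.1.le hδ0.2.le,
      lintegral_union measurableSet_Ioc (Ioc_disjoint_Ioc_of_le le_rfl)]
    refine (add_le_add hL hR).trans_lt ?_
    rw [← ENNReal.ofReal_add (by have := Real.rpow_nonneg hδ0.1.le (1 - b); positivity)
      (by norm_num), ENNReal.ofReal_lt_one]
    linarith
  exact hlt1.ne hmass

theorem bounded_add {s t : ℕ → ℝ} (hs : ∃ B, ∀ n, |s n| ≤ B) (ht : ∃ B, ∀ n, |t n| ≤ B) :
    ∃ B, ∀ n, |s n + t n| ≤ B := by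
  obtain ⟨B, hB⟩ := hs
  obtain ⟨D, hD⟩ := ht
  exact ⟨B + D, fun n => (abs_add_le _ _).trans (add_le_add (hB n) (hD n))⟩

theorem bounded_const_mul (c : ℝ) {s : ℕ → ℝ} (hs : ∃ B, ∀ n, |s n| ≤ B) :
    ∃ B, ∀ n, |c * s n| ≤ B := by
  obtain ⟨B, hB⟩ := hs
  refine ⟨|c| * B, fun n => ?_⟩
  rw [abs_mul]
  exact mul_le_mul_of_nonneg_left (hB n) (abs_nonneg c)

theorem bounded_const (c : ℝ) : ∃ B, ∀ _ : ℕ, |c| ≤ B := ⟨|c|, fun _ => le_rfl⟩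

theorem IsBanachLimit.linear {Λ : (ℕ → ℝ) → ℝ} (hΛ : IsBanachLimit Λ) (c d : ℝ) {s t : ℕ → ℝ}
    (hs : ∃ B, ∀ n, |s n| ≤ B) (ht : ∃ B, ∀ n, |t n| ≤ B) :
    Λ (fun n => c * s n + d * t n) = c * Λ s + d * Λ t := by
  rw [hΛ.add _ _ (bounded_const_mul c hs) (bounded_const_mul d ht), hΛ.smul c s hs,
    hΛ.smul d t ht]

theorem transfer_eq (a : ℝ) (f : ℝ → ℝ) (x : ℝ) :
    transfer a f x = (leftDeriv a (leftInv a x))⁻¹ * f (leftInv a x) + 2⁻¹ * f ((x + 1) / 2) := by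
  rw [transfer, div_eq_inv_mul, div_eq_inv_mul]

theorem bounded_transfer {a : ℝ} (ha : 0 < a) {F : ℕ → ℝ → ℝ}
    (hF : ∀ x ∈ Ioc (0 : ℝ) 1, ∃ B, ∀ n, |F n x| ≤ B) {x : ℝ} (hx : x ∈ Ioc (0 : ℝ) 1) :
    ∃ B, ∀ n, |transfer a (F n) x| ≤ B := by
  simp only [transfer_eq]
  exact bounded_add (bounded_const_mul _ (hF _ (leftInv_mem_Ioc ha hx)))
    (bounded_const_mul _ (hF _ (rightInv_mem_Ioc hx)))

theorem IsBanachLimit.transfer {Λ : (ℕ → ℝ) → ℝ} (hΛ : IsBanachLimit Λ) {a : ℝ} (ha : 0 < a)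
    {F : ℕ → ℝ → ℝ} (hF : ∀ x ∈ Ioc (0 : ℝ) 1, ∃ B, ∀ n, |F n x| ≤ B) {x : ℝ}
    (hx : x ∈ Ioc (0 : ℝ) 1) :
    transfer a (fun y => Λ fun n => F n y) x = Λ fun n => transfer a (F n) x := by
  simp only [transfer_eq]
  exact (hΛ.linear _ _ (hF _ (leftInv_mem_Ioc ha hx)) (hF _ (rightInv_mem_Ioc hx))).symm

theorem IsBanachLimit.randomTransfer {Λ : (ℕ → ℝ) → ℝ} (hΛ : IsBanachLimit Λ) {α β : ℝ}
    (hα : 0 < α) (hβ : 0 < β) (p : ℝ) {F : ℕ → ℝ → ℝ}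
    (hF : ∀ x ∈ Ioc (0 : ℝ) 1, ∃ B, ∀ n, |F n x| ≤ B) {x : ℝ} (hx : x ∈ Ioc (0 : ℝ) 1) :
    randomTransfer α β p (fun y => Λ fun n => F n y) x =
      Λ fun n => randomTransfer α β p (F n) x := by
  unfold _root_.randomTransfer
  rw [hΛ.transfer hα hF hx, hΛ.transfer hβ hF hx]
  exact (hΛ.linear _ _ (bounded_transfer hα hF hx) (bounded_transfer hβ hF hx)).symm

theorem DensityCone.abs_le {b C : ℝ} {f : ℝ → ℝ} (hf : DensityCone b C f) {x : ℝ}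
    (hx : x ∈ Ioc (0 : ℝ) 1) : |f x| ≤ C * x ^ (-b) := by
  rw [abs_of_nonneg (hf.nonneg x hx)]
  exact hf.le_rpow hx

theorem IsBanachLimit.densityCone {Λ : (ℕ → ℝ) → ℝ} (hΛ : IsBanachLimit Λ) {b C : ℝ}
    {F : ℕ → ℝ → ℝ} (hF : ∀ n, DensityCone b C (F n)) :
    DensityCone b C (fun x => Λ fun n => F n x) := by
  have hbd : ∀ x ∈ Ioc (0 : ℝ) 1, ∃ B, ∀ n, |F n x| ≤ B := fun x hx =>
    ⟨C * x ^ (-b), fun n => (hF n).abs_le hx⟩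
  refine ⟨fun x hx => ?_, fun x hx y hy hxy => ?_, fun x hx y hy hxy => ?_, fun x hx => ?_⟩
  · rw [← hΛ.const 0]
    exact hΛ.mono _ _ (bounded_const 0) (hbd x hx) fun n => (hF n).nonneg x hx
  · exact hΛ.mono _ _ (hbd y hy) (hbd x hx) fun n => (hF n).antitone hx hy hxy
  · simp only
    rw [← hΛ.smul _ _ (hbd x hx), ← hΛ.smul _ _ (hbd y hy)]
    exact hΛ.mono _ _ (bounded_const_mul _ (hbd x hx)) (bounded_const_mul _ (hbd y hy))
      fun n => (hF n).mono hx hy hxy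
  · rw [← hΛ.smul _ _ (hbd x hx), ← hΛ.const C]
    exact hΛ.mono _ _ (bounded_const_mul _ (hbd x hx)) (bounded_const C)
      fun n => (hF n).bound x hx

/-- The averaged transfer operator has a nontrivial fixed point in the cone. -/
theorem exists_fixed_density {α β p : ℝ} (hα : 0 < α) (hαβ : α < β) (hβ : β < 1)
    (hp : 0 < p) (hp' : p < 1) :
    ∃ f : ℝ → ℝ, DensityCone β (6 / (1 - β)) f ∧
      (∀ x ∈ Ioc (0 : ℝ) 1, randomTransfer α β p f x = f x) ∧
      ∃ δ ∈ Ioc (0 : ℝ) 1, 1 / 2 ≤ f δ := by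
  obtain ⟨Λ, hΛ⟩ := exists_isBanachLimit
  have hit := iterate_randomTransfer hα hαβ hβ hp hp'
  set F : ℕ → ℝ → ℝ := fun n => (randomTransfer α β p)^[n] fun _ => 1 with hFdef
  have hF : ∀ n, DensityCone β (6 / (1 - β)) (F n) := fun n => (hit n).1
  have hbd : ∀ x ∈ Ioc (0 : ℝ) 1, ∃ B, ∀ n, |F n x| ≤ B := fun x hx =>
    ⟨_, fun n => (hF n).abs_le hx⟩
  have hC : 0 < 6 / (1 - β) := div_pos (by norm_num) (by linarith)
  obtain ⟨δ, hδ, hhalf⟩ := exists_half_le_apply hβ hC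
  refine ⟨_, hΛ.densityCone hF, fun x hx => ?_, δ, hδ, ?_⟩
  · rw [hΛ.randomTransfer hα (hα.trans hαβ) p hbd hx, ← hΛ.shift _ (hbd x hx)]
    simp only [hFdef, Function.iterate_succ_apply']
  · rw [← hΛ.const (1 / 2)]
    exact hΛ.mono _ _ (bounded_const _) (hbd δ hδ) fun n => hhalf _ (hF n) (hit n).2

theorem DensityCone.lipschitzOnWith_Icc {b C c : ℝ} (hb : 0 < b) (hc : 0 < c) {f : ℝ → ℝ}
    (hf : DensityCone b C f) : ∃ L : NNReal, LipschitzOnWith L f (Icc c 1) := by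
  rcases lt_or_ge 1 c with h1 | h1
  · exact ⟨0, by simp [Icc_eq_empty h1.not_ge]⟩
  have hc1 : c ∈ Ioc (0 : ℝ) 1 := ⟨hc, h1⟩
  have hfc := hf.nonneg c hc1
  refine ⟨⟨f c * (b + 1) / c, by positivity⟩, LipschitzOnWith.of_dist_le_mul ?_⟩
  have key : ∀ x ∈ Icc c 1, ∀ y ∈ Icc c 1, x ≤ y →
      |f x - f y| ≤ f c * (b + 1) / c * |x - y| := by
    intro x hx y hy hxy
    have hx' : x ∈ Ioc (0 : ℝ) 1 := ⟨hc.trans_le hx.1, hx.2⟩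
    have hy' : y ∈ Ioc (0 : ℝ) 1 := ⟨hc.trans_le hy.1, hy.2⟩
    have hx0 := hx'.1
    have hy0 := hy'.1
    have hfx := hf.nonneg x hx'
    have hanti := hf.antitone hx' hy' hxy
    rw [abs_of_nonneg (sub_nonneg.mpr hanti), abs_sub_comm, abs_of_nonneg (sub_nonneg.mpr hxy)]
    have hB := one_add_mul_self_le_rpow_one_add (s := x / y - 1)
      (by have : 0 ≤ x / y := by positivity
          linarith) (p := b + 1) (by linarith)
    rw [add_sub_cancel] at hB
    have hm : (x / y) ^ (b + 1) * f x ≤ f y := by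
      have h := hf.mono hx' hy' hxy
      simp only at h
      rw [Real.div_rpow hx0.le hy0.le, div_mul_eq_mul_div, div_le_iff₀ (by positivity)]
      linarith
    calc f x - f y ≤ f x * ((b + 1) * (1 - x / y)) := by
          linarith [mul_le_mul_of_nonneg_right hB hfx]
      _ = f x * (b + 1) / y * (y - x) := by field_simp
      _ ≤ f c * (b + 1) / c * (y - x) := by
          have h1 : f x ≤ f c := hf.antitone hc1 hx' hx.1
          have h2 : 0 ≤ y - x := by linarith
          have h3 := hy.1
          gcongr
  intro x hx y hy
  rw [Real.dist_eq, Real.dist_eq]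
  rcases le_total x y with h | h
  · exact key x hx y hy h
  · rw [abs_sub_comm, abs_sub_comm x]
    exact key y hy x hx h

theorem exists_subset_Icc_of_isCompact {K : Set ℝ} (hK : K ⊆ Ioc 0 1) (hc : IsCompact K) :
    ∃ c : ℝ, 0 < c ∧ K ⊆ Icc c 1 := by
  rcases K.eq_empty_or_nonempty with rfl | hne
  · exact ⟨1, one_pos, empty_subset _⟩
  · obtain ⟨c, hcK, hmin⟩ := hc.exists_isLeast hne
    exact ⟨c, (hK hcK).1, fun x hx => ⟨hmin hx, (hK hx).2⟩⟩

theorem random_map_stationary_density (α β p₁ : ℝ) (hα : 0 < α) (hαβ : α < β) (hβ : β < 1)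
    (hp₁ : 0 < p₁) (hp₁' : p₁ < 1) :
    ∃ μ : Measure ℝ, IsProbabilityMeasure μ ∧ μ ≪ (volume : Measure ℝ) ∧
      μ ((Icc (0 : ℝ) 1)ᶜ) = 0 ∧
      (∀ A : Set ℝ, MeasurableSet A →
        μ A = ENNReal.ofReal p₁ * μ (lsv α ⁻¹' A) + ENNReal.ofReal (1 - p₁) * μ (lsv β ⁻¹' A)) ∧
      ∃ g : ℝ → ℝ,
        μ = volume.withDensity (fun x => ENNReal.ofReal (g x)) ∧
        ∀ K : Set ℝ, K ⊆ Ioc (0 : ℝ) 1 → IsCompact K →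
          ∃ L : NNReal, LipschitzOnWith L g K := by
  obtain ⟨f, hf, hfix, δ, hδ, hhalf⟩ := exists_fixed_density hα hαβ hβ hp₁ hp₁'
  have hC : 0 < 6 / (1 - β) := div_pos (by norm_num) (by linarith)
  set M : ENNReal := ∫⁻ x in Ioc 0 1, ENNReal.ofReal (f x) with hM
  have hMtop : M ≠ ⊤ :=
    ((hf.lintegral_le hβ hC.le zero_le_one le_rfl).trans_lt ENNReal.ofReal_lt_top).ne
  have hM0 : M ≠ 0 := by
    have hle : ∫⁻ _ in Ioc 0 δ, ENNReal.ofReal (1 / 2) ≤ M :=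
      (setLIntegral_mono' measurableSet_Ioc fun x hx => ENNReal.ofReal_le_ofReal
        (hhalf.trans (hf.antitone ⟨hx.1, hx.2.trans hδ.2⟩ hδ hx.2))).trans
        (lintegral_mono_set (Ioc_subset_Ioc_right hδ.2))
    rw [setLIntegral_const, Real.volume_Ioc, sub_zero, ← ENNReal.ofReal_mul (by norm_num)] at hle
    have : 0 < ENNReal.ofReal (1 / 2 * δ) := ENNReal.ofReal_pos.mpr (by linarith [hδ.1])
    exact (this.trans_le hle).ne'
  have hMpos : 0 < M.toReal := ENNReal.toReal_pos hM0 hMtop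
  have hMinv : 0 ≤ M.toReal⁻¹ := inv_nonneg.mpr hMpos.le
  set g : ℝ → ℝ := (Ioc (0 : ℝ) 1).indicator fun x => M.toReal⁻¹ * f x with hg
  set μ : Measure ℝ := volume.withDensity fun x => ENNReal.ofReal (g x) with hμ
  have hμA : ∀ A : Set ℝ, MeasurableSet A →
      μ A = ENNReal.ofReal M.toReal⁻¹ * ∫⁻ x in A ∩ Ioc 0 1, ENNReal.ofReal (f x) := by
    intro A hA
    have hind : (fun x => ENNReal.ofReal (g x)) =
        (Ioc (0 : ℝ) 1).indicator fun x => ENNReal.ofReal M.toReal⁻¹ * ENNReal.ofReal (f x) := by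
      ext x
      by_cases hx : x ∈ Ioc (0 : ℝ) 1
      · simp only [hg, indicator_of_mem hx, ENNReal.ofReal_mul hMinv]
      · simp only [hg, indicator_of_notMem hx, ENNReal.ofReal_zero]
    rw [hμ, withDensity_apply _ hA, hind, setLIntegral_indicator measurableSet_Ioc,
      inter_comm, lintegral_const_mul' _ _ ENNReal.ofReal_ne_top]
  refine ⟨μ, ⟨?_⟩, withDensity_absolutelyContinuous _ _, ?_, ?_, g, rfl, ?_⟩
  · rw [hμA _ MeasurableSet.univ, univ_inter, ← hM, ENNReal.ofReal_inv_of_pos hMpos,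
      ENNReal.ofReal_toReal hMtop, ENNReal.inv_mul_cancel hM0 hMtop]
  · have hempty : (Icc (0 : ℝ) 1)ᶜ ∩ Ioc 0 1 = ∅ :=
      (disjoint_compl_left.mono_right Ioc_subset_Icc_self).inter_eq
    rw [hμA _ measurableSet_Icc.compl, hempty]
    simp
  · intro A hA
    rw [hμA A hA, hμA _ (measurable_lsv α hA), hμA _ (measurable_lsv β hA),
      ← setLIntegral_congr_fun (hA.inter measurableSet_Ioc)
        fun x hx => congrArg ENNReal.ofReal (hfix x hx.2),
      lintegral_randomTransfer hα (hα.trans hαβ) hp₁.le hp₁'.le hf.nonneg hf.antitone hA]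
    ring
  · intro K hK hKc
    obtain ⟨c, hc, hKsub⟩ := exists_subset_Icc_of_isCompact hK hKc
    obtain ⟨L, hL⟩ := hf.lipschitzOnWith_Icc (hα.trans hαβ) hc
    refine ⟨‖M.toReal⁻¹‖₊ * L, LipschitzOnWith.of_dist_le_mul fun x hx y hy => ?_⟩
    rw [hg, indicator_of_mem (hK hx), indicator_of_mem (hK hy), ← smul_eq_mul, ← smul_eq_mul,
      dist_smul₀, NNReal.coe_mul, mul_assoc, coe_nnnorm]
    gcongr
    exact hL.dist_le_mul x (hKsub hx) y (hKsub hy)
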